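/- arXiv:2003.12379 — 2 statements merged into one kernel-verified Lean document; each statement's English description precedes it below -/
import Mathlib

section
/- Every very well-covered graph has a perfect matching. That is, if G is a finite simple graph without isolated vertices such that |V(G)| is even and every maximal independent set of vertices of G has cardinality |V(G)|/2, then there is a matching M ⊆ E(G) such that every vertex of G is incident to exactly one edge of M. -/
/-- An independent set in a graph. -/
def IsIndepSet {V : Type*} (G : SimpleGraph V) (A : Set V) : Prop :=
  A.Pairwise fun u v => ¬ G.Adj u v

/-- A maximal independent set in a graph. -/
def IsMaxIndepSet {V : Type*} (G : SimpleGraph V) (A : Set V) : Prop :=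
  IsIndepSet G A ∧ ∀ B, IsIndepSet G B → A ⊆ B → A = B

/-- A graph has no isolated vertices. -/
def HasNoIsolatedVertices {V : Type*} (G : SimpleGraph V) : Prop :=
  ∀ v, ∃ u, G.Adj v u

/-- A graph is very well-covered if it has no isolated vertices, an even number of
vertices, and every maximal independent set has cardinality half the number of vertices. -/
def IsVeryWellCovered {V : Type*} [Fintype V] (G : SimpleGraph V) : Prop :=
  HasNoIsolatedVertices G ∧ Even (Fintype.card V) ∧
    ∀ A : Set V, IsMaxIndepSet G A → A.ncard = Fintype.card V / 2

theorem IsIndepSet.exists_isMaxIndepSet_superset {V : Type*} [Finite V] {G : SimpleGraph V}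
    {S : Set V} (hS : IsIndepSet G S) : ∃ B, S ⊆ B ∧ IsMaxIndepSet G B := by
  obtain ⟨B, hSB, hB⟩ := (Set.toFinite {B : Set V | IsIndepSet G B}).exists_le_maximal hS
  exact ⟨B, hSB, hB.prop, fun C hC hBC => hBC.antisymm (hB.le_of_ge hC hBC)⟩

/-- If all maximal independent sets have the same size and there are no isolated vertices,
then every independent set has at least as many neighbors as elements. -/
theorem IsIndepSet.card_le_card_biUnion_neighborFinset {V : Type*} [Fintype V] [DecidableEq V]
    {G : SimpleGraph V} [DecidableRel G.Adj] (hiso : HasNoIsolatedVertices G) {c : ℕ}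
    (hc : ∀ A : Set V, IsMaxIndepSet G A → A.ncard = c) (S : Finset V)
    (hS : IsIndepSet G (S : Set V)) :
    S.card ≤ (S.biUnion fun v => G.neighborFinset v).card := by
  classical
  induction S using Finset.strongInduction with
  | H S ih =>
  obtain rfl | ⟨x, hx⟩ := S.eq_empty_or_nonempty
  · simp
  obtain ⟨y, hxy⟩ := hiso x
  obtain ⟨B', hyB', hB'⟩ := IsIndepSet.exists_isMaxIndepSet_superset (G := G) (S := {y})
    (Set.pairwise_singleton _ _)
  obtain ⟨B, rfl⟩ := B'.toFinite.exists_finset_coe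
  have hyB : y ∈ B := by simpa using hyB'
  have hBind : ∀ u ∈ B, ∀ v ∈ B, ¬ G.Adj u v := fun u hu v hv h => hB'.1 hu hv h.ne h
  have hSind : ∀ u ∈ S, ∀ v ∈ S, ¬ G.Adj u v := fun u hu v hv h => hS hu hv h.ne h
  set N := S.biUnion fun v => G.neighborFinset v with hN
  have hmemN : ∀ v, v ∈ N ↔ ∃ u ∈ S, G.Adj u v := by simp [hN]
  have hexchange : IsIndepSet G (((B \ N) ∪ (S \ B) : Finset V) : Set V) := by
    intro u hu v hv _ h
    simp only [Finset.coe_union, Finset.coe_sdiff, Set.mem_union, Set.mem_sdiff,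
      Finset.mem_coe, hmemN] at hu hv
    rcases hu with hu | hu <;> rcases hv with hv | hv
    · exact hBind u hu.1 v hv.1 h
    · exact hu.2 ⟨v, hv.1, h.symm⟩
    · exact hv.2 ⟨u, hu.1, h⟩
    · exact hSind u hu.1 v hv.1 h
  obtain ⟨C, hC, hCmax⟩ := hexchange.exists_isMaxIndepSet_superset
  have hle := Set.ncard_le_ncard hC C.toFinite
  rw [hc C hCmax, ← hc _ hB', Set.ncard_coe_finset, Set.ncard_coe_finset,
    Finset.card_union_of_disjoint (Finset.disjoint_left.2 fun a ha hb =>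
      (Finset.mem_sdiff.1 hb).2 (Finset.mem_sdiff.1 ha).1)] at hle
  have hssub : S ∩ B ⊂ S := by
    refine Finset.ssubset_iff_subset_ne.2 ⟨Finset.inter_subset_left, fun h => ?_⟩
    exact hBind x (Finset.inter_eq_left.1 h hx) y hyB hxy
  have hind := ih _ hssub (hS.mono (by simp))
  have hsub : ((S ∩ B).biUnion fun v => G.neighborFinset v) ⊆ N \ B := by
    intro v hv
    simp only [Finset.mem_biUnion, Finset.mem_inter, SimpleGraph.mem_neighborFinset] at hv
    obtain ⟨u, ⟨huS, huB⟩, huv⟩ := hv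
    exact Finset.mem_sdiff.2 ⟨(hmemN v).2 ⟨u, huS, huv⟩, fun hvB => hBind u huB v hvB huv⟩
  have h1 := Finset.card_le_card hsub
  have h2 := Finset.card_inter_add_card_sdiff S B
  have h3 := Finset.card_inter_add_card_sdiff N B
  have h4 := Finset.card_inter_add_card_sdiff B N
  rw [Finset.inter_comm] at h4
  omega

/-- Every very well-covered graph has a perfect matching: a set `M` of edges of `G` such
that every vertex is incident to exactly one edge of `M`. -/
theorem veryWellCovered_has_perfect_matching {V : Type*} [Fintype V] (G : SimpleGraph V)
    (hG : IsVeryWellCovered G) :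
    ∃ M ⊆ G.edgeSet, ∀ v : V, ∃! e : Sym2 V, e ∈ M ∧ v ∈ e := by
  classical
  obtain ⟨hiso, heven, hc⟩ := hG
  obtain ⟨A', -, hA'⟩ := IsIndepSet.exists_isMaxIndepSet_superset (G := G) (S := ∅)
    (Set.pairwise_empty _)
  obtain ⟨A, rfl⟩ := A'.toFinite.exists_finset_coe
  have hcard : A.card = Fintype.card V / 2 := by
    rw [← hc _ hA', Set.ncard_coe_finset]
  obtain ⟨f, hf, hadj⟩ := (Finset.all_card_le_biUnion_card_iff_exists_injective
    fun a : A => G.neighborFinset (a : V)).1 (by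
      intro S
      have h := IsIndepSet.card_le_card_biUnion_neighborFinset hiso hc
        (S.map (Function.Embedding.subtype _)) (hA'.1.mono (by intro v; simp; tauto))
      simpa [Finset.map_eq_image, Finset.image_biUnion, Finset.card_image_of_injective,
        Subtype.val_injective] using h)
  simp only [SimpleGraph.mem_neighborFinset] at hadj
  have hfA : ∀ a, f a ∉ A := fun a h => hA'.1 a.2 h (hadj a).ne (hadj a)
  have himage : Finset.univ.image f = Aᶜ := by
    refine Finset.eq_of_subset_of_card_le (fun v hv => ?_) ?_
    · obtain ⟨a, -, rfl⟩ := Finset.mem_image.1 hv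
      exact Finset.mem_compl.2 (hfA a)
    · rw [Finset.card_image_of_injective _ hf, Finset.card_univ, Fintype.card_coe,
        Finset.card_compl, hcard]
      have := Nat.two_mul_div_two_of_even heven
      omega
  refine ⟨Set.range fun a : A => s((a : V), f a), ?_, fun v => ?_⟩
  · rintro _ ⟨a, rfl⟩
    exact hadj a
  · by_cases hv : v ∈ A
    · refine ⟨s(v, f ⟨v, hv⟩), ⟨⟨⟨v, hv⟩, rfl⟩, Sym2.mem_mk_left _ _⟩, ?_⟩
      rintro _ ⟨⟨a, rfl⟩, hva⟩
      rcases Sym2.mem_iff.1 hva with rfl | rfl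
      · rfl
      · exact absurd hv (hfA a)
    · obtain ⟨a, -, rfl⟩ := Finset.mem_image.1 (himage ▸ Finset.mem_compl.2 hv)
      refine ⟨s((a : V), f a), ⟨⟨a, rfl⟩, Sym2.mem_mk_right _ _⟩, ?_⟩
      rintro _ ⟨⟨b, rfl⟩, hb⟩
      rcases Sym2.mem_iff.1 hb with h | h
      · exact absurd (h ▸ b.2) hv
      · rw [hf h]
end

section
/- Let G be a very well-covered graph with 2h vertices, labeled so that condition (*) holds: V(G) is the disjoint union of the minimal vertex cover X = {x_1,…,x_h} and the maximal independent set Y = {y_1,…,y_h} with x_i y_i ∈ E(G) for all i. Let w : E(G) → Z_{>0} be an edge weight. Then the edge-weighted edge ideal I(G_w) is unmixed if and only if the following hold: (i) if x_i z_j ∈ E(G) for distinct indices i, j and z_j ∈ {x_j, y_j}, then w(x_i z_j) ≤ w(x_i y_i) and w(x_i z_j) ≤ w(x_j y_j); (ii) if z_i x_j ∈ E(G) and y_j x_k ∈ E(G), either for distinct indices i, j, k and z_i ∈ {x_i, y_i}, or for i = k distinct from j and z_i = y_i, then w(z_i x_k) ≤ w(z_i x_j) and w(z_i x_k) ≤ w(y_j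 x_k). -/
/-- A vertex cover of a graph. -/
def IsVertexCover {V : Type*} (G : SimpleGraph V) (C : Set V) : Prop :=
  ∀ ⦃u v⦄, G.Adj u v → u ∈ C ∨ v ∈ C

/-- A minimal vertex cover of a graph. -/
def IsMinVertexCover {V : Type*} (G : SimpleGraph V) (C : Set V) : Prop :=
  IsVertexCover G C ∧ ∀ B ⊆ C, IsVertexCover G B → B = C

/-- Condition (*) for a graph on the `2h` vertices `x_1, …, x_h, y_1, …, y_h`
(encoded as `Sum.inl 0, …, Sum.inl (h-1), Sum.inr 0, …, Sum.inr (h-1)`):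
`X = {x_1, …, x_h}` is a minimal vertex cover, `Y = {y_1, …, y_h}` is a maximal
independent set, and `x_i y_i` is an edge for every `i`. -/
def CondStar {h : ℕ} (G : SimpleGraph (Fin h ⊕ Fin h)) : Prop :=
  IsMinVertexCover G (Set.range Sum.inl) ∧
    IsMaxIndepSet G (Set.range Sum.inr) ∧
    ∀ i : Fin h, G.Adj (Sum.inl i) (Sum.inr i)

/-- The height of an ideal `p` (intended: a prime ideal), i.e. the Krull dimension of the
set of prime ideals contained in `p`. -/
noncomputable def idealHeight {R : Type*} [CommRing R] (p : Ideal R) : WithBot ℕ∞ :=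
  Order.krullDim {q : PrimeSpectrum R // q.asIdeal ≤ p}

/-- An ideal `I ⊆ R` is unmixed if all associated primes of `R ⧸ I` have the same height. -/
def IsUnmixedIdeal {R : Type*} [CommRing R] (I : Ideal R) : Prop :=
  ∀ p ∈ associatedPrimes R (R ⧸ I), ∀ q ∈ associatedPrimes R (R ⧸ I),
    idealHeight p = idealHeight q

/-- The monomial associated to a weighted edge: `(X u * X v) ^ w(e)` for `e = uv`. -/
noncomputable def edgeMonomial {V : Type*} (K : Type*) [CommSemiring K]
    (w : Sym2 V → ℕ) (e : Sym2 V) : MvPolynomial V K :=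
  (Sym2.lift ⟨fun u v => MvPolynomial.X u * MvPolynomial.X v,
    fun u v => mul_comm _ _⟩ e) ^ w e

/-- The edge-weighted edge ideal `I(G_w)` of an edge-weighted graph `G_w`. -/
noncomputable def weightedEdgeIdeal {V : Type*} (K : Type*) [CommSemiring K]
    (G : SimpleGraph V) (w : Sym2 V → ℕ) : Ideal (MvPolynomial V K) :=
  Ideal.span (edgeMonomial K w '' G.edgeSet)

open MvPolynomial

section Combinatorics

/-- An independent set contained in a finite graph extends to a maximal one. -/
lemma IsIndepSet.exists_isMaxIndepSet {V : Type*} [Finite V] {G : SimpleGraph V} {A : Set V}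
    (hA : IsIndepSet G A) : ∃ B, A ⊆ B ∧ IsMaxIndepSet G B := by
  obtain ⟨B, hAB, hB⟩ := (Set.toFinite {B : Set V | IsIndepSet G B}).exists_le_maximal hA
  exact ⟨B, hAB, hB.prop, fun C hC hBC => hBC.antisymm (hB.le_of_ge hC hBC)⟩

variable {h : ℕ} {G : SimpleGraph (Fin h ⊕ Fin h)}

lemma IsIndepSet.exists_transversal (hvwc : IsVeryWellCovered G) (hstar : CondStar G)
    {A : Set (Fin h ⊕ Fin h)} (hA : IsIndepSet G A) :
    ∃ B, A ⊆ B ∧ IsIndepSet G B ∧ ∀ i : Fin h, Sum.inl i ∈ B ∨ Sum.inr i ∈ B := by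
  obtain ⟨B, hAB, hB⟩ := hA.exists_isMaxIndepSet
  refine ⟨B, hAB, hB.1, fun i => ?_⟩
  have hcard : B.ncard = h := by
    rw [hvwc.2.2 B hB, Fintype.card_sum, Fintype.card_fin]
    lia
  have hinj : Set.InjOn (Sum.elim id id : Fin h ⊕ Fin h → Fin h) B := by
    rintro (a | a) ha (b | b) hb hab <;> obtain rfl : a = b := hab
    · rfl
    · exact absurd (hstar.2.2 a) (hB.1 ha hb (by simp))
    · exact absurd (hstar.2.2 a).symm (hB.1 ha hb (by simp))
    · rfl
  have himage : Sum.elim id id '' B = (Set.univ : Set (Fin h)) := by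
    apply Set.eq_of_subset_of_ncard_le (Set.subset_univ _)
    rw [hinj.ncard_image, hcard, Set.ncard_univ, Nat.card_eq_fintype_card,
      Fintype.card_fin]
  obtain ⟨v | v, hv, hvi⟩ : i ∈ Sum.elim id id '' B := himage ▸ Set.mem_univ i
  · exact Or.inl ((show v = i from hvi) ▸ hv)
  · exact Or.inr ((show v = i from hvi) ▸ hv)

lemma adj_of_adj_inl_of_adj_inr (hvwc : IsVeryWellCovered G) (hstar : CondStar G)
    {z z' : Fin h ⊕ Fin h} {j : Fin h} (hz : G.Adj z (Sum.inl j))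
    (hz' : G.Adj (Sum.inr j) z') : G.Adj z z' := by
  by_contra hadj
  have hA : IsIndepSet G {z, z'} :=
    (Set.pairwise_pair).2 fun _ => ⟨hadj, fun hadj' => hadj hadj'.symm⟩
  obtain ⟨B, hAB, hB, htrans⟩ := hA.exists_transversal hvwc hstar
  rcases htrans j with hj | hj
  · exact hB (hAB (by simp)) hj hz.ne hz
  · exact hB hj (hAB (by simp)) hz'.ne hz'

lemma not_adj_inr_of_adj_inl (hvwc : IsVeryWellCovered G) (hstar : CondStar G)
    {z : Fin h ⊕ Fin h} {j : Fin h} (hz : G.Adj z (Sum.inl j)) : ¬ G.Adj z (Sum.inr j) := by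
  intro hz'
  have hA : IsIndepSet G {z} := Set.pairwise_singleton z _
  obtain ⟨B, hAB, hB, htrans⟩ := hA.exists_transversal hvwc hstar
  rcases htrans j with hj | hj
  · exact hB (hAB rfl) hj hz.ne hz
  · exact hB (hAB rfl) hj hz'.ne hz'

lemma not_adj_inr_inr (hstar : CondStar G) (i j : Fin h) :
    ¬ G.Adj (Sum.inr i) (Sum.inr j) := fun hij =>
  hstar.2.1.1 (Set.mem_range_self i) (Set.mem_range_self j) hij.ne hij

end Combinatorics

section EdgeIdeal

variable {V K : Type*} [Field K] {G : SimpleGraph V} {w : Sym2 V → ℕ}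

/-- The monomial with exponent `m` is divisible by a generator of the weighted edge ideal. -/
def EdgeDivides (G : SimpleGraph V) (w : Sym2 V → ℕ) (m : V → ℕ) : Prop :=
  ∃ u v, G.Adj u v ∧ w s(u, v) ≤ m u ∧ w s(u, v) ≤ m v

lemma EdgeDivides.mono {m n : V → ℕ} (hm : EdgeDivides G w m) (hmn : m ≤ n) :
    EdgeDivides G w n := by
  obtain ⟨u, v, huv, hu, hv⟩ := hm
  exact ⟨u, v, huv, hu.trans (hmn u), hv.trans (hmn v)⟩

lemma mem_weightedEdgeIdeal_iff {f : MvPolynomial V K} :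
    f ∈ weightedEdgeIdeal K G w ↔ ∀ m ∈ f.support, EdgeDivides G w m := by
  classical
  have hgen : weightedEdgeIdeal K G w = Ideal.span ((fun s => monomial s (1 : K)) ''
      {s | ∃ u v, G.Adj u v ∧
        s = Finsupp.single u (w s(u, v)) + Finsupp.single v (w s(u, v))}) := by
    have hmon (u v : V) (n : ℕ) : (X u * X v : MvPolynomial V K) ^ n =
        monomial (Finsupp.single u n + Finsupp.single v n) 1 := by
      rw [mul_pow, X_pow_eq_monomial, X_pow_eq_monomial, monomial_mul, one_mul]
    unfold weightedEdgeIdeal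
    congr 1
    ext g
    constructor
    · rintro ⟨e, he, rfl⟩
      induction e with | h u v =>
      exact ⟨_, ⟨u, v, he, rfl⟩, (hmon u v _).symm⟩
    · rintro ⟨_, ⟨u, v, huv, rfl⟩, rfl⟩
      exact ⟨s(u, v), huv, hmon u v _⟩
  rw [hgen, mem_ideal_span_monomial_image]
  refine forall₂_congr fun m _ => ⟨?_, ?_⟩
  · rintro ⟨_, ⟨u, v, huv, rfl⟩, hle⟩
    have hne := huv.ne
    have h₁ := hle u
    have h₂ := hle v
    simp only [Finsupp.add_apply, Finsupp.single_eq_same, Finsupp.single_apply, hne, hne.symm,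
      if_false, add_zero, zero_add] at h₁ h₂
    exact ⟨u, v, huv, h₁, h₂⟩
  · rintro ⟨u, v, huv, hu, hv⟩
    refine ⟨_, ⟨u, v, huv, rfl⟩, fun x => ?_⟩
    have hne := huv.ne
    simp only [Finsupp.add_apply, Finsupp.single_apply]
    grind

lemma monomial_mem_weightedEdgeIdeal_iff {m : V →₀ ℕ} :
    monomial m (1 : K) ∈ weightedEdgeIdeal K G w ↔ EdgeDivides G w m := by
  classical
  rw [mem_weightedEdgeIdeal_iff, support_monomial, if_neg one_ne_zero]
  simp

lemma edge_mem_of_weightedEdgeIdeal_le {p : Ideal (MvPolynomial V K)} [p.IsPrime]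
    (hp : weightedEdgeIdeal K G w ≤ p) {u v : V} (huv : G.Adj u v) :
    X u ∈ p ∨ X v ∈ p := by
  have hmem : (X u * X v : MvPolynomial V K) ^ w s(u, v) ∈ p :=
    hp (Ideal.subset_span ⟨s(u, v), huv, rfl⟩)
  exact Ideal.IsPrime.mem_or_mem ‹_› (Ideal.IsPrime.mem_of_pow_mem ‹_› _ hmem)

lemma mem_associatedPrimes_quotient_iff {R : Type*} [CommRing R] [IsNoetherianRing R]
    {I p : Ideal R} : p ∈ associatedPrimes R (R ⧸ I) ↔
      p.IsPrime ∧ ∃ f, ∀ g, g ∈ p ↔ g * f ∈ I := by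
  rw [AssociatedPrimes.mem_iff, isAssociatedPrime_iff]
  refine and_congr_right fun _ => ?_
  constructor
  · rintro ⟨x, rfl⟩
    obtain ⟨f, rfl⟩ := Ideal.Quotient.mk_surjective x
    refine ⟨f, fun g => ?_⟩
    rw [Submodule.mem_colon_singleton, Submodule.mem_bot, ← Ideal.Quotient.eq_zero_iff_mem,
      map_mul]
    rfl
  · rintro ⟨f, hf⟩
    refine ⟨Ideal.Quotient.mk I f, ?_⟩
    ext g
    rw [Submodule.mem_colon_singleton, Submodule.mem_bot, hf, ← Ideal.Quotient.eq_zero_iff_mem,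
      map_mul]
    rfl

lemma exists_coeff_eq_ite (f : MvPolynomial V K) (P : (V →₀ ℕ) → Prop) [DecidablePred P] :
    ∃ g : MvPolynomial V K, ∀ m, coeff m g = if P m then coeff m f else 0 := by
  classical
  refine ⟨∑ n ∈ f.support with P n, monomial n (coeff n f), fun m => ?_⟩
  simp only [coeff_sum, coeff_monomial, Finset.sum_ite_eq', Finset.mem_filter, mem_support_iff]
  split_ifs <;> grind

/-- A prime annihilating a nonzero class modulo a weighted edge ideal is generated by the
variables it contains, provided these variables form a vertex cover. -/
lemma eq_span_X_of_annihilator [Finite V] {p : Ideal (MvPolynomial V K)} [p.IsPrime]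
    {f : MvPolynomial V K} (hf : ∀ g, g ∈ p ↔ g * f ∈ weightedEdgeIdeal K G w) :
    p = Ideal.span (X '' {v | X v ∈ p}) := by
  classical
  have := Fintype.ofFinite V
  set I := weightedEdgeIdeal K G w
  have hle : Ideal.span (X '' {v | X v ∈ p}) ≤ p := by
    rw [Ideal.span_le]
    rintro _ ⟨v, hv, rfl⟩
    exact hv
  have hIp : I ≤ p := fun g hg => (hf g).2 (I.mul_mem_right _ hg)
  refine le_antisymm (fun g hg => ?_) hle
  by_contra hgC
  obtain ⟨g', hg'⟩ := exists_coeff_eq_ite g fun m => ∀ v, X v ∈ p → m v = 0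
  have hgg' : g - g' ∈ Ideal.span (X '' {v | X v ∈ p}) := by
    rw [mem_ideal_span_X_image]
    intro m hm
    rw [mem_support_iff, coeff_sub, hg'] at hm
    by_contra! hcon
    have hP : ∀ v, X v ∈ p → m v = 0 := hcon
    exact hm (by rw [if_pos hP, sub_self])
  have hg'p : g' ∈ p := by simpa using p.sub_mem hg (hle hgg')
  have hg'0 : g' ≠ 0 := by
    rintro rfl
    exact hgC (by simpa using hgg')
  obtain ⟨N, hN⟩ : ∃ N, ∀ e, w e ≤ N :=
    ⟨Finset.univ.sup w, fun e => Finset.le_sup (Finset.mem_univ e)⟩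
  let n : V →₀ ℕ := Finsupp.equivFunOnFinite.symm fun v => if X v ∈ p then 0 else N
  have hnp : monomial n (1 : K) ∉ p := by
    rw [monomial_eq, C_1, one_mul, Finsupp.prod]
    intro hmem
    obtain ⟨v, hv, hvp⟩ := (Ideal.IsPrime.prod_mem_iff (p := p)).1 hmem
    have := Ideal.IsPrime.mem_of_pow_mem ‹p.IsPrime› _ hvp
    simp [n, this] at hv
  obtain ⟨f', hf'⟩ := exists_coeff_eq_ite (monomial n 1 * f) fun m => ¬ EdgeDivides G w m
  have hff' : monomial n 1 * f - f' ∈ I := by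
    rw [mem_weightedEdgeIdeal_iff]
    intro m hm
    rw [mem_support_iff, coeff_sub, hf'] at hm
    by_contra hcon
    exact hm (by rw [if_pos hcon, sub_self])
  have hf'0 : f' ≠ 0 := by
    rintro rfl
    exact hnp ((hf _).2 (by simpa using hff'))
  have hgf' : g' * f' ∈ I := by
    have h₁ := I.mul_mem_left (monomial n 1) ((hf g').1 hg'p)
    have h₂ := I.sub_mem h₁ (I.mul_mem_left g' hff')
    convert h₂ using 1
    ring
  obtain ⟨c, hc⟩ := exists_coeff_ne_zero (mul_ne_zero hg'0 hf'0)
  have hdiv := mem_weightedEdgeIdeal_iff.1 hgf' c (mem_support_iff.2 hc)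
  rw [coeff_mul] at hc
  obtain ⟨⟨a, b⟩, hab, hne⟩ := Finset.exists_ne_zero_of_sum_ne_zero hc
  obtain rfl : a + b = c := Finset.HasAntidiagonal.mem_antidiagonal.1 hab
  have ha := left_ne_zero_of_mul hne
  have hb := right_ne_zero_of_mul hne
  simp only [hg', hf', ne_eq, ite_eq_right_iff, Classical.not_imp] at ha hb
  have hnb : ∀ v, X v ∉ p → N ≤ b v := by
    intro v hv
    have hb' := hb.2
    rw [coeff_monomial_mul'] at hb'
    have hnb : n ≤ b := by
      by_contra hcon
      exact hb' (if_neg hcon)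
    simpa [n, hv] using hnb v
  obtain ⟨u, v, huv, hu, hv⟩ := hdiv
  refine hb.1 ⟨u, v, huv, ?_, ?_⟩
  · by_cases hup : X u ∈ p
    · simpa [ha.1 u hup] using hu
    · exact (hN _).trans (hnb u hup)
  · by_cases hvp : X v ∈ p
    · simpa [ha.1 v hvp] using hv
    · exact (hN _).trans (hnb v hvp)

/-- If a prime contains a variable from an independent set containing all variables outside
the prime, then it strictly contains a prime over the weighted edge ideal. -/
lemma exists_prime_lt_of_isIndepSet (hw : ∀ e ∈ G.edgeSet, 0 < w e)
    {p : Ideal (MvPolynomial V K)} {B : Set V} (hB : IsIndepSet G B)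
    (hpB : {v | X v ∉ p} ⊆ B) {v : V} (hvB : v ∈ B) (hvp : X v ∈ p) :
    ∃ q : Ideal (MvPolynomial V K), q.IsPrime ∧ weightedEdgeIdeal K G w ≤ q ∧ q < p := by
  classical
  let φ : MvPolynomial V K →ₐ[K] MvPolynomial V K :=
    aeval fun v => if v ∈ B then X v else 0
  have hφX (v) : φ (X v) = if v ∈ B then X v else 0 := aeval_X _ v
  have hgen (u u' : V) (n : ℕ) (huu' : G.Adj u u') (hn : 0 < n) : φ ((X u * X u') ^ n) = 0 := by
    rw [map_pow, map_mul, hφX, hφX]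
    by_cases hu : u ∈ B
    · have hu' : u' ∉ B := fun hu' => hB hu hu' huu'.ne huu'
      rw [if_neg hu', mul_zero, zero_pow hn.ne']
    · rw [if_neg hu, zero_mul, zero_pow hn.ne']
  have hIφ : weightedEdgeIdeal K G w ≤ RingHom.ker φ := by
    rw [weightedEdgeIdeal, Ideal.span_le]
    rintro _ ⟨e, he, rfl⟩
    induction e with | h u u' =>
    rw [SetLike.mem_coe, RingHom.mem_ker, edgeMonomial]
    exact hgen u u' _ he (hw _ he)
  have hmk : (Ideal.Quotient.mk p).comp (φ : MvPolynomial V K →+* MvPolynomial V K) = Ideal.Quotient.mk p := by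
    apply MvPolynomial.ringHom_ext
    · intro r
      change Ideal.Quotient.mk p (φ (C r)) = _
      rw [← algebraMap_eq, AlgHom.commutes]
    · intro v
      change Ideal.Quotient.mk p (φ (X v)) = _
      rw [hφX]
      split_ifs with hv
      · rfl
      · rw [map_zero, eq_comm, Ideal.Quotient.eq_zero_iff_mem]
        by_contra hvp
        exact hv (hpB hvp)
  have hφp : RingHom.ker φ < p := by
    refine lt_of_le_of_ne (fun g hg => ?_) fun heq => ?_
    · rw [← Ideal.Quotient.eq_zero_iff_mem, ← hmk]
      change Ideal.Quotient.mk p (φ g) = 0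
      rw [(hg : φ g = 0), map_zero]
    · rw [← heq] at hvp
      have hzero : φ (X v) = 0 := hvp
      rw [hφX, if_pos hvB] at hzero
      exact X_ne_zero v hzero
  exact ⟨RingHom.ker φ, RingHom.ker_isPrime _, hIφ, hφp⟩

end EdgeIdeal

section Height

lemma idealHeight_lt_of_lt {R : Type*} [CommRing R] [IsNoetherianRing R] {p q : Ideal R}
    [hp : p.IsPrime] [hq : q.IsPrime] (hpq : p < q) : idealHeight p < idealHeight q := by
  have key (r : Ideal R) [hr : r.IsPrime] : idealHeight r = (r.height : WithBot ℕ∞) := by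
    rw [PrimeSpectrum.height_eq_orderHeight ⟨r, hr⟩, Order.height_eq_krullDim_Iic]
    rfl
  rw [key p, key q]
  exact WithBot.coe_lt_coe.2 (Ideal.height_strict_mono_of_isPrime_of_isPrime hpq)

lemma idealHeight_map_equiv {R : Type*} [CommRing R] (e : R ≃+* R) (p : Ideal R) :
    idealHeight (p.map e) = idealHeight p := by
  refine (Order.krullDim_eq_of_orderIso ?_).symm
  refine
    { toEquiv := (PrimeSpectrum.comapEquiv e).toEquiv.subtypeEquiv fun q => ?_
      map_rel_iff' := fun {a b} => (PrimeSpectrum.comapEquiv e).le_iff_le }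
  change q.asIdeal ≤ p ↔ q.asIdeal.comap e.symm ≤ p.map e
  rw [← Ideal.comap_symm, Ideal.comap_le_comap_iff_of_surjective _ e.symm.surjective]

lemma idealHeight_span_X_eq {V K : Type*} [Finite V] [Field K] {C D : Set V}
    (hCD : C.ncard = D.ncard) :
    idealHeight (Ideal.span (X '' C : Set (MvPolynomial V K))) =
      idealHeight (Ideal.span (X '' D : Set (MvPolynomial V K))) := by
  classical
  have := Fintype.ofFinite V
  let e : C ≃ D := (Finite.card_eq.1 hCD).some
  let σ : Equiv.Perm V := Equiv.extendSubtype (p := (· ∈ C)) (q := (· ∈ D)) e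
  have hσ : σ '' C = D := by
    refine Set.eq_of_subset_of_ncard_le ?_ ?_ (Set.toFinite D)
    · rintro _ ⟨v, hv, rfl⟩
      exact Equiv.extendSubtype_mem _ v hv
    · rw [Set.ncard_image_of_injective _ σ.injective, hCD]
  rw [← idealHeight_map_equiv (renameEquiv K σ).toRingEquiv, Ideal.map_span, ← hσ,
    ← Set.image_comp, ← Set.image_comp]
  congr 3
  funext v
  simp

end Height

section Unmixed

variable {h : ℕ} {K : Type*} [Field K] {G : SimpleGraph (Fin h ⊕ Fin h)}
  {w : Sym2 (Fin h ⊕ Fin h) → ℕ}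

lemma edgeDivides_of_isUnmixedIdeal (hvwc : IsVeryWellCovered G) (hstar : CondStar G)
    (hw : ∀ e ∈ G.edgeSet, 0 < w e) (hI : IsUnmixedIdeal (weightedEdgeIdeal K G w))
    {m : Fin h ⊕ Fin h → ℕ} {i : Fin h}
    (hl : EdgeDivides G w (m + Pi.single (Sum.inl i) 1))
    (hr : EdgeDivides G w (m + Pi.single (Sum.inr i) 1)) : EdgeDivides G w m := by
  classical
  by_contra hm
  set I := weightedEdgeIdeal K G w
  let n : Fin h ⊕ Fin h →₀ ℕ := Finsupp.equivFunOnFinite.symm m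
  have hn : monomial n (1 : K) ∉ I := fun hmem => hm (monomial_mem_weightedEdgeIdeal_iff.1 hmem)
  obtain ⟨p, hp, hnp⟩ := exists_le_isAssociatedPrime_of_isNoetherianRing (MvPolynomial (Fin h ⊕ Fin h) K)
    (Ideal.Quotient.mk I (monomial n 1)) (by rwa [ne_eq, Ideal.Quotient.eq_zero_iff_mem])
  have hprime : p.IsPrime := hp.isPrime
  replace hnp : ∀ g, g * monomial n 1 ∈ I → g ∈ p := by
    intro g hg
    apply hnp
    rw [Submodule.mem_colon_singleton, Submodule.mem_bot]
    rw [← Ideal.Quotient.eq_zero_iff_mem, map_mul] at hg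
    exact hg
  have hX (v) (hv : EdgeDivides G w (m + Pi.single v 1)) : X v ∈ p := by
    apply hnp
    rw [X, monomial_mul, one_mul, monomial_mem_weightedEdgeIdeal_iff]
    convert hv using 1
    funext u
    simp [n, Finsupp.single_apply, Pi.single_apply, add_comm, eq_comm]
  have hIp : I ≤ p := fun g hg => hnp g (I.mul_mem_right _ hg)
  have hindep : IsIndepSet G {v | X v ∉ p} := fun u hu v hv _ huv =>
    (edge_mem_of_weightedEdgeIdeal_le hIp huv).elim hu hv
  obtain ⟨B, hpB, hB, htrans⟩ := hindep.exists_transversal hvwc hstar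
  obtain ⟨v, hvB, hvp⟩ : ∃ v ∈ B, X v ∈ p :=
    (htrans i).elim (fun hi => ⟨_, hi, hX _ hl⟩) fun hi => ⟨_, hi, hX _ hr⟩
  obtain ⟨r, hr, hIr, hrp⟩ := exists_prime_lt_of_isIndepSet hw hB hpB hvB hvp
  obtain ⟨q, hq, hqr⟩ := Ideal.exists_minimalPrimes_le hIr
  have hqprime : q.IsPrime := hq.1.1
  have hqass : q ∈ associatedPrimes (MvPolynomial _ K) (MvPolynomial _ K ⧸ I) := by
    apply Module.associatedPrimes.minimalPrimes_annihilator_subset_associatedPrimes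
    rwa [Ideal.annihilator_quotient]
  exact (idealHeight_lt_of_lt (hqr.trans_lt hrp)).ne (hI q hqass p hp)

lemma isUnmixedIdeal_of_edgeDivides (hstar : CondStar G)
    (H : ∀ (m : Fin h ⊕ Fin h → ℕ) (i : Fin h), EdgeDivides G w (m + Pi.single (Sum.inl i) 1) →
      EdgeDivides G w (m + Pi.single (Sum.inr i) 1) → EdgeDivides G w m) :
    IsUnmixedIdeal (weightedEdgeIdeal K G w) := by
  classical
  set I := weightedEdgeIdeal K G w
  have key : ∀ p ∈ associatedPrimes (MvPolynomial _ K) (MvPolynomial _ K ⧸ I),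
      ∃ C : Set (Fin h ⊕ Fin h), C.ncard = h ∧ p = Ideal.span (X '' C) := by
    intro p hp
    obtain ⟨hprime, f, hf⟩ := mem_associatedPrimes_quotient_iff.1 hp
    have hIp : I ≤ p := fun g hg => (hf g).2 (I.mul_mem_right _ hg)
    refine ⟨_, ?_, eq_span_X_of_annihilator hf⟩
    have hfI : f ∉ I := fun hfI => hprime.ne_top
      ((Ideal.eq_top_iff_one p).2 ((hf 1).2 (by rwa [one_mul])))
    have hnot : ∀ i : Fin h, X (Sum.inl i) ∈ p → X (Sum.inr i) ∉ p := by
      intro i hl hr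
      apply hfI
      rw [mem_weightedEdgeIdeal_iff]
      intro m hm
      have hX (v : Fin h ⊕ Fin h) (hv : X v ∈ p) : EdgeDivides G w (⇑m + Pi.single v 1) := by
        have hmem := mem_weightedEdgeIdeal_iff.1 ((hf _).1 hv) (Finsupp.single v 1 + m)
          (by rw [mem_support_iff, coeff_X_mul]; exact mem_support_iff.1 hm)
        convert hmem using 1
        funext u
        simp [Finsupp.single_apply, Pi.single_apply, add_comm, eq_comm]
      exact H m i (hX _ hl) (hX _ hr)
    have hinj : Set.InjOn (Sum.elim id id : Fin h ⊕ Fin h → Fin h) {v | X v ∈ p} := by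
      rintro (a | a) ha (b | b) hb hab <;> obtain rfl : a = b := hab
      · rfl
      · exact absurd hb (hnot a ha)
      · exact absurd ha (hnot a hb)
      · rfl
    have himage : Sum.elim id id '' {v | X v ∈ p} = (Set.univ : Set (Fin h)) := by
      refine Set.eq_univ_of_forall fun i => ?_
      rcases edge_mem_of_weightedEdgeIdeal_le hIp (hstar.2.2 i) with hi | hi
      · exact ⟨_, hi, rfl⟩
      · exact ⟨_, hi, rfl⟩
    rw [← hinj.ncard_image, himage, Set.ncard_univ, Nat.card_eq_fintype_card,
      Fintype.card_fin]
  intro p hp q hq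
  obtain ⟨C, hC, rfl⟩ := key p hp
  obtain ⟨D, hD, rfl⟩ := key q hq
  exact idealHeight_span_X_eq (hC.trans hD.symm)

/-- If raising the exponent of `z` makes a monomial divisible by a generator, then so does
some edge at `z`. -/
lemma exists_adj_of_edgeDivides_add_single {V : Type*} [DecidableEq V] {G : SimpleGraph V}
    {w : Sym2 V → ℕ} {m : V → ℕ} {z : V} (hm : ¬ EdgeDivides G w m)
    (hz : EdgeDivides G w (m + Pi.single z 1)) :
    ∃ u, G.Adj z u ∧ w s(z, u) = m z + 1 ∧ w s(z, u) ≤ m u := by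
  obtain ⟨u, v, huv, hu, hv⟩ := hz
  have hne := huv.ne
  have hcon : ¬ (w s(u, v) ≤ m u ∧ w s(u, v) ≤ m v) := fun hcon => hm ⟨u, v, huv, hcon⟩
  simp only [Pi.add_apply, Pi.single_apply] at hu hv
  by_cases huz : u = z
  · subst huz
    refine ⟨v, huv, ?_, ?_⟩ <;> grind
  · by_cases hvz : v = z
    · subst hvz
      refine ⟨u, huv.symm, ?_, ?_⟩ <;> rw [Sym2.eq_swap] <;> grind
    · grind

end Unmixed

section Weights

variable {V : Type*} [DecidableEq V] {G : SimpleGraph V} {w : Sym2 V → ℕ} {a b z z' : V}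

lemma weight_le_of_adj (hw : ∀ e ∈ G.edgeSet, 0 < w e)
    (H : ∀ m : V → ℕ, EdgeDivides G w (m + Pi.single a 1) →
      EdgeDivides G w (m + Pi.single b 1) → EdgeDivides G w m)
    (hab : G.Adj a b) (haz : G.Adj a z) (hzb : z ≠ b) (hnzb : ¬ G.Adj z b) :
    w s(a, z) ≤ w s(a, b) := by
  by_contra! hlt
  have hne₁ := hab.ne
  have hne₂ := haz.ne
  have hpos := hw _ (G.mem_edgeSet.2 hab)
  let m : V → ℕ := fun v => if v = a then w s(a, z) - 1 else if v = b then w s(a, b) - 1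
    else if v = z then w s(a, z) else 0
  have hma : m a = w s(a, z) - 1 := if_pos rfl
  have hmb : m b = w s(a, b) - 1 := by simp [m, hne₁.symm]
  have hmz : m z = w s(a, z) := by simp [m, hne₂.symm, hzb]
  have hm0 (v) (hv : 0 < m v) : v = a ∨ v = b ∨ v = z := by
    by_contra! hcon
    simp [m, hcon] at hv
  obtain ⟨u, v, huv, hu, hv⟩ := H m
    ⟨a, z, haz, by simp [hma]; lia, by simp [hmz]⟩
    ⟨a, b, hab, by simp [hma, hne₁]; lia, by simp [hmb]; lia⟩
  have hwuv := hw _ (G.mem_edgeSet.2 huv)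
  have huv' := huv.ne
  rcases hm0 u (by lia) with rfl | rfl | rfl <;> rcases hm0 v (by lia) with rfl | rfl | rfl <;>
    first
    | exact huv' rfl
    | exact hnzb huv
    | exact hnzb huv.symm
    | lia
    | (rw [Sym2.eq_swap] at hu hv hwuv; lia)

lemma weight_le_of_adj_of_adj (hw : ∀ e ∈ G.edgeSet, 0 < w e)
    (H : ∀ m : V → ℕ, EdgeDivides G w (m + Pi.single a 1) →
      EdgeDivides G w (m + Pi.single b 1) → EdgeDivides G w m)
    (hab : G.Adj a b) (hza : G.Adj z a) (hbz' : G.Adj b z') (hzz' : z ≠ z') (hzb : z ≠ b)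
    (hz'a : z' ≠ a) (hnzb : ¬ G.Adj z b) (hnz'a : ¬ G.Adj z' a) (hle : w s(z, a) ≤ w s(a, b)) :
    w s(z, z') ≤ w s(z, a) ∧ w s(z, z') ≤ w s(b, z') := by
  by_contra! hlt
  have hne₁ := hab.ne
  have hne₂ := hza.ne
  have hne₃ := hbz'.ne
  have hpos₁ := hw _ (G.mem_edgeSet.2 hza)
  have hpos₂ := hw _ (G.mem_edgeSet.2 hbz')
  let m : V → ℕ := fun v => if v = a then w s(z, a) - 1 else if v = b then w s(b, z') - 1
    else if v = z then w s(z, a) else if v = z' then w s(b, z') else 0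
  have hma : m a = w s(z, a) - 1 := if_pos rfl
  have hmb : m b = w s(b, z') - 1 := by simp [m, hne₁.symm]
  have hmz : m z = w s(z, a) := by simp [m, hne₂, hzb]
  have hmz' : m z' = w s(b, z') := by simp [m, hz'a, hne₃.symm, hzz'.symm]
  have hm0 (v) (hv : 0 < m v) : v = a ∨ v = b ∨ v = z ∨ v = z' := by
    by_contra! hcon
    simp [m, hcon] at hv
  obtain ⟨u, v, huv, hu, hv⟩ := H m
    ⟨z, a, hza, by simp [hmz], by simp [hma]; lia⟩
    ⟨b, z', hbz', by simp [hmb]; lia, by simp [hmz']⟩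
  have hwuv := hw _ (G.mem_edgeSet.2 huv)
  have huv' := huv.ne
  rcases hm0 u (by lia) with rfl | rfl | rfl | rfl <;>
    rcases hm0 v (by lia) with rfl | rfl | rfl | rfl <;>
    first
    | exact huv' rfl
    | exact hnzb huv
    | exact hnzb huv.symm
    | exact hnz'a huv
    | exact hnz'a huv.symm
    | lia
    | (rw [Sym2.eq_swap] at hu hv hwuv; lia)

end Weights

/-- Characterization of unmixedness of the edge-weighted edge ideal of a very
well-covered graph labeled so that condition (*) holds. -/
theorem weightedEdgeIdeal_unmixed_iff {h : ℕ} (K : Type*) [Field K]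
    (G : SimpleGraph (Fin h ⊕ Fin h)) (hvwc : IsVeryWellCovered G) (hstar : CondStar G)
    (w : Sym2 (Fin h ⊕ Fin h) → ℕ) (hw : ∀ e ∈ G.edgeSet, 0 < w e) :
    IsUnmixedIdeal (weightedEdgeIdeal K G w) ↔
      ((∀ i j : Fin h, i ≠ j → ∀ z : Fin h ⊕ Fin h,
          (z = Sum.inl j ∨ z = Sum.inr j) → G.Adj (Sum.inl i) z →
          w s(Sum.inl i, z) ≤ w s(Sum.inl i, Sum.inr i) ∧
            w s(Sum.inl i, z) ≤ w s(Sum.inl j, Sum.inr j)) ∧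
        (∀ i j k : Fin h, ∀ z : Fin h ⊕ Fin h,
          ((i ≠ j ∧ j ≠ k ∧ i ≠ k ∧ (z = Sum.inl i ∨ z = Sum.inr i)) ∨
            (i = k ∧ i ≠ j ∧ z = Sum.inr i)) →
          G.Adj z (Sum.inl j) → G.Adj (Sum.inr j) (Sum.inl k) →
          w s(z, Sum.inl k) ≤ w s(z, Sum.inl j) ∧
            w s(z, Sum.inl k) ≤ w s(Sum.inr j, Sum.inl k))) := by
  have hxy := hstar.2.2
  constructor
  · intro hI
    have H (i : Fin h) (m : Fin h ⊕ Fin h → ℕ) :=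
      edgeDivides_of_isUnmixedIdeal (m := m) (i := i) hvwc hstar hw hI
    have hleft {i : Fin h} {z : Fin h ⊕ Fin h} (hz : G.Adj (Sum.inl i) z) (hne : z ≠ Sum.inr i) :
        w s(Sum.inl i, z) ≤ w s(Sum.inl i, Sum.inr i) :=
      weight_le_of_adj hw (H i) (hxy i) hz hne (not_adj_inr_of_adj_inl hvwc hstar hz.symm)
    have hright {i : Fin h} {z : Fin h ⊕ Fin h} (hz : G.Adj (Sum.inr i) z) (hne : z ≠ Sum.inl i) :
        w s(Sum.inr i, z) ≤ w s(Sum.inr i, Sum.inl i) :=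
      weight_le_of_adj hw (fun m h₁ h₂ => H i m h₂ h₁) (hxy i).symm hz hne fun hzi =>
        not_adj_inr_of_adj_inl hvwc hstar hzi hz.symm
    constructor
    · rintro i j hij z hz hadj
      refine ⟨hleft hadj ?_, ?_⟩
      · rcases hz with rfl | rfl <;> simp [hij.symm]
      · rw [Sym2.eq_swap (a := Sum.inl i)]
        rcases hz with rfl | rfl
        · exact hleft hadj.symm (by simp)
        · rw [Sym2.eq_swap (a := Sum.inl j)]
          exact hright hadj.symm (by simpa using hij)
    · rintro i j k z hz hzj hjk
      have hkj : Sum.inl k ≠ (Sum.inl j : Fin h ⊕ Fin h) := by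
        rintro hkj
        rcases hz with ⟨-, hjk', -⟩ | ⟨rfl, hij, -⟩
        · exact hjk' (Sum.inl_injective hkj).symm
        · exact hij (Sum.inl_injective hkj)
      have hzr : z ≠ Sum.inr j := by
        rcases hz with ⟨hij, -, -, rfl | rfl⟩ | ⟨-, hij, rfl⟩ <;> simp [*]
      have hzk : z ≠ Sum.inl k := by
        rcases hz with ⟨-, -, hik, rfl | rfl⟩ | ⟨-, -, rfl⟩ <;> simp [*]
      refine weight_le_of_adj_of_adj hw (H j) (hxy j) hzj hjk hzk hzr hkj
        (not_adj_inr_of_adj_inl hvwc hstar hzj)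
        (fun hkj => not_adj_inr_of_adj_inl hvwc hstar hkj hjk.symm) ?_
      rw [Sym2.eq_swap]
      exact hleft hzj.symm hzr
  · rintro ⟨h₁, h₂⟩
    refine isUnmixedIdeal_of_edgeDivides hstar fun m j hl hr => ?_
    by_contra hm
    obtain ⟨z, hz, hwz, hmz⟩ := exists_adj_of_edgeDivides_add_single hm hl
    obtain ⟨z', hz', hwz', hmz'⟩ := exists_adj_of_edgeDivides_add_single hm hr
    obtain ⟨k, rfl⟩ : ∃ k, z' = Sum.inl k := by
      rcases z' with k | k
      · exact ⟨k, rfl⟩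
      · exact absurd hz' (not_adj_inr_inr hstar j k)
    have hswap : w s(Sum.inr j, Sum.inl j) = w s(Sum.inl j, Sum.inr j) := by rw [Sym2.eq_swap]
    by_cases hzj : z = Sum.inr j
    · subst hzj
      have hkj : k ≠ j := by
        rintro rfl
        lia
      have := (h₁ k j hkj _ (Or.inr rfl) hz'.symm).2
      rw [Sym2.eq_swap] at this
      lia
    obtain ⟨i, hi⟩ : ∃ i, z = Sum.inl i ∨ z = Sum.inr i := by
      rcases z with i | i
      · exact ⟨i, Or.inl rfl⟩
      · exact ⟨i, Or.inr rfl⟩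
    have hij : i ≠ j := by
      rintro rfl
      rcases hi with rfl | rfl
      · exact hz.ne rfl
      · exact hzj rfl
    have hle := (h₁ j i hij.symm z hi hz).1
    have hjk : j ≠ k := by
      rintro rfl
      lia
    have hzk : z ≠ Sum.inl k := by
      rintro rfl
      exact not_adj_inr_of_adj_inl hvwc hstar hz.symm hz'.symm
    have hcases : (i ≠ j ∧ j ≠ k ∧ i ≠ k ∧ (z = Sum.inl i ∨ z = Sum.inr i)) ∨
        (i = k ∧ i ≠ j ∧ z = Sum.inr i) := by
      by_cases hik : i = k
      · subst hik
        exact Or.inr ⟨rfl, hij, hi.resolve_left hzk⟩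
      · exact Or.inl ⟨hij, hjk, hik, hi⟩
    obtain ⟨hle₁, hle₂⟩ := h₂ i j k z hcases hz.symm hz'
    rw [Sym2.eq_swap (a := z) (b := Sum.inl j)] at hle₁
    exact hm ⟨z, Sum.inl k, adj_of_adj_inl_of_adj_inr hvwc hstar hz.symm hz',
      hle₁.trans hmz, hle₂.trans hmz'⟩
end
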